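/- Let x : U → ℝ³ be a proper wavefront, Ω a tmb of x, and p ∈ Σ(x) with rank(Dx(p)) = 0. Then: (1) k_{1Ω}(p) = k_{2Ω}(p) = 0; (2) |K(u,v)| → ∞ as (u,v) → p through Σ(x)ᶜ; (3) the functions 1/k₁ and 1/k₂ admit continuous extensions to a neighborhood V of p (given by K_Ω ≠ 0 on V: 1/k₁ = k_{2Ω}/K_Ω and 1/k₂ = k_{1Ω}/K_Ω); (4) |k₁(u,v)| → ∞ and |k₂(u,v)| → ∞ as (u,v) → p through Σ(x)ᶜ; (5) the function 1/k₁ + 1/k₂ admits a C^∞ extension to a neighborhood of p, namely 2H_Ω/K_Ω. -/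

import Mathlib

/- Common framework for frontals and tangent moving bases, following
   "Curvatures on fronts" conventions. -/

noncomputable section

open Matrix Topology Filter

/-- Points of the plane ℝ². -/
abbrev Pt : Type := Fin 2 → ℝ

/-- Jacobian matrix of a map `f : ℝ² → ℝ^m` at a point. -/
def jac {m : ℕ} (f : Pt → (Fin m → ℝ)) (p : Pt) : Matrix (Fin m) (Fin 2) ℝ :=
  Matrix.of fun i j => fderiv ℝ f p (Pi.single j 1) i

/-- Euclidean norm of a vector in ℝ³. -/
def enorm3 (v : Fin 3 → ℝ) : ℝ := Real.sqrt (v ⬝ᵥ v)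

/-- The unit normal vector field induced by a tangent moving base `Ω`,
    `n := (w₁ × w₂)/‖w₁ × w₂‖` where `w₁, w₂` are the columns of `Ω`. -/
def normalOf (Ω : Pt → Matrix (Fin 3) (Fin 2) ℝ) (p : Pt) : Fin 3 → ℝ :=
  (enorm3 (crossProduct (fun i => Ω p i 0) (fun i => Ω p i 1)))⁻¹ •
    crossProduct (fun i => Ω p i 0) (fun i => Ω p i 1)

/-- First fundamental form matrix of a map `y`. -/
def IOf (y : Pt → Fin 3 → ℝ) (p : Pt) : Matrix (Fin 2) (Fin 2) ℝ :=
  (jac y p)ᵀ * jac y p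

/-- Second fundamental form matrix of a map `y` with respect to a unit normal `ν`. -/
def IIOf (y ν : Pt → Fin 3 → ℝ) (p : Pt) : Matrix (Fin 2) (Fin 2) ℝ :=
  -((jac y p)ᵀ * jac ν p)

/-- Weingarten matrix `α := −IIᵀ I⁻¹` of a map `y` with unit normal `ν`. -/
def weinOf (y ν : Pt → Fin 3 → ℝ) (p : Pt) : Matrix (Fin 2) (Fin 2) ℝ :=
  -((IIOf y ν p)ᵀ * (IOf y p)⁻¹)

/-- Gaussian curvature of an immersion `y` with unit normal `ν`. -/
def KgOf (y ν : Pt → Fin 3 → ℝ) (p : Pt) : ℝ :=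
  (IIOf y ν p).det / (IOf y p).det

/-- Mean curvature of an immersion `y` with unit normal `ν`. -/
def HmOf (y ν : Pt → Fin 3 → ℝ) (p : Pt) : ℝ :=
  -(1 / 2) * (weinOf y ν p).trace

/-- Smaller principal curvature `H − √(H² − K)` of an immersion `y`. -/
def k1Of (y ν : Pt → Fin 3 → ℝ) (p : Pt) : ℝ :=
  HmOf y ν p - Real.sqrt ((HmOf y ν p) ^ 2 - KgOf y ν p)

/-- Larger principal curvature `H + √(H² − K)` of an immersion `y`. -/
def k2Of (y ν : Pt → Fin 3 → ℝ) (p : Pt) : ℝ :=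
  HmOf y ν p + Real.sqrt ((HmOf y ν p) ^ 2 - KgOf y ν p)

/-- A frontal `x : U → ℝ³` equipped with a tangent moving base (tmb) `Ω` and the
induced smooth matrix-valued maps `Λ`, `μ` satisfying `Dx = Ω Λᵀ` and `Dn = Ω μᵀ` on `U`. -/
structure Frontal where
  /-- the domain -/
  U : Set Pt
  isOpen_U : IsOpen U
  /-- the frontal -/
  x : Pt → Fin 3 → ℝ
  /-- the tangent moving base -/
  Ω : Pt → Matrix (Fin 3) (Fin 2) ℝ
  /-- `Λ` with `Dx = Ω Λᵀ` -/
  Λ : Pt → Matrix (Fin 2) (Fin 2) ℝ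
  /-- `μ` with `Dn = Ω μᵀ` -/
  μ : Pt → Matrix (Fin 2) (Fin 2) ℝ
  smooth_x : ContDiffOn ℝ (⊤ : ℕ∞) x U
  smooth_Ω : ∀ i j, ContDiffOn ℝ (⊤ : ℕ∞) (fun p => Ω p i j) U
  smooth_Λ : ∀ i j, ContDiffOn ℝ (⊤ : ℕ∞) (fun p => Λ p i j) U
  smooth_μ : ∀ i j, ContDiffOn ℝ (⊤ : ℕ∞) (fun p => μ p i j) U
  /-- the columns of `Ω` are linearly independent (nonzero cross product) -/
  indep : ∀ p ∈ U, crossProduct (fun i => Ω p i 0) (fun i => Ω p i 1) ≠ 0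
  decomp_x : ∀ p ∈ U, jac x p = Ω p * (Λ p)ᵀ
  decomp_n : ∀ p ∈ U, jac (normalOf Ω) p = Ω p * (μ p)ᵀ

namespace Frontal

variable (F : Frontal)

/-- The unit normal induced by the tmb. -/
def n : Pt → Fin 3 → ℝ := normalOf F.Ω

/-- `λ_Ω := det Λ`. -/
def lam (p : Pt) : ℝ := (F.Λ p).det

/-- The Ω-relative curvature `K_Ω := det μ`. -/
def KΩ (p : Pt) : ℝ := (F.μ p).det

/-- `α_Ω := μ · adj(Λ)`. -/
def αΩ (p : Pt) : Matrix (Fin 2) (Fin 2) ℝ := F.μ p * (F.Λ p).adjugate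

/-- The Ω-relative mean curvature `H_Ω := −(1/2) tr α_Ω`. -/
def HΩ (p : Pt) : ℝ := -(1 / 2) * (F.αΩ p).trace

/-- The relative principal curvature `k_{1Ω} := H_Ω − √(H_Ω² − λ_Ω K_Ω)`. -/
def k1Ω (p : Pt) : ℝ := F.HΩ p - Real.sqrt ((F.HΩ p) ^ 2 - F.lam p * F.KΩ p)

/-- The relative principal curvature `k_{2Ω} := H_Ω + √(H_Ω² − λ_Ω K_Ω)`. -/
def k2Ω (p : Pt) : ℝ := F.HΩ p + Real.sqrt ((F.HΩ p) ^ 2 - F.lam p * F.KΩ p)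

/-- The singular set `Σ(x) = λ_Ω⁻¹(0)`. -/
def sing : Set Pt := {p ∈ F.U | F.lam p = 0}

/-- The regular set `U − Σ(x)`. -/
def reg : Set Pt := {p ∈ F.U | F.lam p ≠ 0}

/-- A frontal is proper if its singular set has empty interior. -/
def IsProper : Prop := interior F.sing = ∅

/-- `x` is a wavefront if `(x, n) : U → ℝ³ × S²` is an immersion. -/
def IsWavefront : Prop :=
  ∀ p ∈ F.U, (Matrix.fromRows (jac F.x p) (jac F.n p)).rank = 2

/-- First fundamental form matrix `I = Dxᵀ Dx`. -/
def Imat (p : Pt) : Matrix (Fin 2) (Fin 2) ℝ := IOf F.x p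

/-- Second fundamental form matrix `II = −Dxᵀ Dn`. -/
def IImat (p : Pt) : Matrix (Fin 2) (Fin 2) ℝ := IIOf F.x F.n p

/-- Weingarten matrix `α := −IIᵀ I⁻¹` (meaningful off the singular set). -/
def Wein (p : Pt) : Matrix (Fin 2) (Fin 2) ℝ := weinOf F.x F.n p

/-- Coefficient `e` of the second fundamental form. -/
def e (p : Pt) : ℝ := F.IImat p 0 0

/-- Coefficient `f` of the second fundamental form. -/
def f (p : Pt) : ℝ := F.IImat p 0 1

/-- Coefficient `g` of the second fundamental form. -/
def g (p : Pt) : ℝ := F.IImat p 1 1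

/-- Gaussian curvature (meaningful off the singular set). -/
def Kg (p : Pt) : ℝ := KgOf F.x F.n p

/-- Mean curvature (meaningful off the singular set). -/
def Hm (p : Pt) : ℝ := HmOf F.x F.n p

/-- Principal curvature `κ₋ := H − √(H² − K)`. -/
def κm (p : Pt) : ℝ := F.Hm p - Real.sqrt ((F.Hm p) ^ 2 - F.Kg p)

/-- Principal curvature `κ₊ := H + √(H² − K)`. -/
def κp (p : Pt) : ℝ := F.Hm p + Real.sqrt ((F.Hm p) ^ 2 - F.Kg p)

/-- `k₁ := κ₋` where `λ_Ω > 0` and `k₁ := κ₊` where `λ_Ω < 0`. -/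
def k1 (p : Pt) : ℝ := if 0 < F.lam p then F.κm p else F.κp p

/-- `k₂ := κ₊` where `λ_Ω > 0` and `k₂ := κ₋` where `λ_Ω < 0`. -/
def k2 (p : Pt) : ℝ := if 0 < F.lam p then F.κp p else F.κm p

/-- `x` is parallelly smoothable at `p` : for some `ε > 0` and some open
neighborhood `V` of `p`, `rank D(x + l·n)(q) = 2` for all `(q,l) ∈ V × (0,ε)`
or for all `(q,l) ∈ V × (−ε,0)`. -/
def ParSmoothable (p : Pt) : Prop :=
  ∃ ε > (0 : ℝ), ∃ V : Set Pt, IsOpen V ∧ p ∈ V ∧ V ⊆ F.U ∧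
    ((∀ q ∈ V, ∀ l ∈ Set.Ioo (0 : ℝ) ε,
        (jac (fun z => F.x z + l • F.n z) q).rank = 2) ∨
     (∀ q ∈ V, ∀ l ∈ Set.Ioo (-ε) (0 : ℝ),
        (jac (fun z => F.x z + l • F.n z) q).rank = 2))

/-- `f` (defined off the singular set) has a `C^∞` extension to `V`. -/
def SmoothExtOn (f : Pt → ℝ) (V : Set Pt) : Prop :=
  ∃ g : Pt → ℝ, ContDiffOn ℝ (⊤ : ℕ∞) g V ∧ ∀ q ∈ V ∩ F.reg, g q = f q

/-- `f` has a `C^∞` extension to some open neighborhood of `p`. -/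
def SmoothExtNear (f : Pt → ℝ) (p : Pt) : Prop :=
  ∃ V : Set Pt, IsOpen V ∧ p ∈ V ∧ V ⊆ F.U ∧ F.SmoothExtOn f V

/-- Membership in the principal ideal `𝔗_Ω(V)` generated by `λ_Ω` in `C^∞(V,ℝ)`. -/
def memIdeal (f : Pt → ℝ) (V : Set Pt) : Prop :=
  ∃ φ : Pt → ℝ, ContDiffOn ℝ (⊤ : ℕ∞) φ V ∧ ∀ q ∈ V, f q = φ q * F.lam q

end Frontal

/-- `f` does not change sign on `V`. -/
def NoSignChange (f : Pt → ℝ) (V : Set Pt) : Prop :=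
  (∀ q ∈ V, 0 ≤ f q) ∨ (∀ q ∈ V, f q ≤ 0)

/-- Squared-trace inequality for a pair of symmetric binary forms, the first positive definite. -/
theorem symm_pair_discrim_nonneg {E F G e f g : ℝ} (hE : 0 ≤ E) (hd : 0 < E * G - F ^ 2) :
    0 ≤ (e * G - 2 * f * F + g * E) ^ 2 - 4 * (e * g - f ^ 2) * (E * G - F ^ 2) := by
  have hE' : 0 < E := by
    rcases hE.lt_or_eq with h | h
    · exact h
    · subst h
      nlinarith [sq_nonneg F]
  have key : E ^ 2 * ((e * G - 2 * f * F + g * E) ^ 2 - 4 * (e * g - f ^ 2) * (E * G - F ^ 2)) =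
      4 * (E * G - F ^ 2) * (E * f - F * e) ^ 2 +
        (E * (E * g - G * e) - 2 * F * (E * f - F * e)) ^ 2 := by
    ring
  refine nonneg_of_mul_nonneg_right (a := E ^ 2) ?_ (by positivity)
  rw [key]
  positivity

theorem det_transpose_mul_self_eq_cross (A : Matrix (Fin 3) (Fin 2) ℝ) :
    (Aᵀ * A).det = crossProduct (fun i => A i 0) (fun i => A i 1) ⬝ᵥ
      crossProduct (fun i => A i 0) (fun i => A i 1) := by
  simp only [Matrix.det_fin_two, Matrix.mul_apply, Matrix.transpose_apply, cross_apply,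
    dotProduct, Fin.sum_univ_three, Matrix.cons_val_zero, Matrix.cons_val_one, Matrix.cons_val]
  ring

theorem dotProduct_self_pos_of_ne_zero {v : Fin 3 → ℝ} (hv : v ≠ 0) : 0 < v ⬝ᵥ v := by
  refine lt_of_le_of_ne ?_ (Ne.symm (mt dotProduct_self_eq_zero.1 hv))
  exact Finset.sum_nonneg fun i _ => mul_self_nonneg _

theorem differentiableAt_normalOf {Ω : Pt → Matrix (Fin 3) (Fin 2) ℝ} {q : Pt}
    (hΩ : ∀ i j, DifferentiableAt ℝ (fun p => Ω p i j) q)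
    (h0 : crossProduct (fun i => Ω q i 0) (fun i => Ω q i 1) ≠ 0) :
    DifferentiableAt ℝ (normalOf Ω) q := by
  have hc : DifferentiableAt ℝ
      (fun p => crossProduct (fun i => Ω p i 0) (fun i => Ω p i 1)) q := by
    rw [differentiableAt_pi]
    intro i
    fin_cases i <;> simp only [cross_apply] <;>
      exact ((hΩ _ _).mul (hΩ _ _)).sub ((hΩ _ _).mul (hΩ _ _))
  have hpos := dotProduct_self_pos_of_ne_zero h0
  have hs : DifferentiableAt ℝ (fun p =>
      enorm3 (crossProduct (fun i => Ω p i 0) (fun i => Ω p i 1))) q := by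
    refine DifferentiableAt.sqrt ?_ hpos.ne'
    simp only [dotProduct]
    refine DifferentiableAt.fun_sum fun i _ => ?_
    exact (differentiableAt_pi.1 hc i).mul (differentiableAt_pi.1 hc i)
  exact (hs.inv (Real.sqrt_pos.2 hpos).ne').smul hc

namespace Frontal

variable {F : Frontal} {q : Pt}

theorem gram_det_pos (hq : q ∈ F.U) : 0 < ((F.Ω q)ᵀ * F.Ω q).det := by
  rw [det_transpose_mul_self_eq_cross]
  exact dotProduct_self_pos_of_ne_zero (F.indep q hq)

theorem normal_dotProduct_base (q : Pt) (j : Fin 2) : F.n q ⬝ᵥ (fun i => F.Ω q i j) = 0 := by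
  unfold n normalOf
  rw [smul_dotProduct, dotProduct_comm]
  fin_cases j
  · exact (congrArg _ (dot_self_cross _ _)).trans (smul_zero _)
  · exact (congrArg _ (dot_cross_self _ _)).trans (smul_zero _)

theorem normal_dotProduct_jac (hq : q ∈ F.U) (j : Fin 2) :
    ∑ i, F.n q i * jac F.x q i j = 0 := by
  rw [F.decomp_x q hq]
  have h0 := F.normal_dotProduct_base q 0
  have h1 := F.normal_dotProduct_base q 1
  simp only [dotProduct, Fin.sum_univ_three] at h0 h1
  simp only [Matrix.mul_apply, Fin.sum_univ_two, Fin.sum_univ_three, Matrix.transpose_apply]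
  linear_combination (F.Λ q j 0) * h0 + (F.Λ q j 1) * h1

theorem differentiableAt_n (hq : q ∈ F.U) : DifferentiableAt ℝ F.n q := by
  refine differentiableAt_normalOf (fun i j => ?_) (F.indep q hq)
  exact ((F.smooth_Ω i j).contDiffAt (F.isOpen_U.mem_nhds hq)).differentiableAt (by simp)

theorem jac_dotProduct_jac_normal (hq : q ∈ F.U) (j k : Fin 2) :
    ∑ i, jac F.x q i j * jac F.n q i k =
      -∑ i, F.n q i * fderiv ℝ (fderiv ℝ F.x) q (Pi.single k 1) (Pi.single j 1) i := by
  have hx : ContDiffAt ℝ (⊤ : ℕ∞) F.x q := F.smooth_x.contDiffAt (F.isOpen_U.mem_nhds hq)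
  have hd : DifferentiableAt ℝ (fderiv ℝ F.x) q :=
    (hx.fderiv_right (m := 1) (by norm_cast)).differentiableAt (by simp)
  have hn (i : Fin 3) : HasFDerivAt (fun z => F.n z i)
      ((ContinuousLinearMap.proj i).comp (fderiv ℝ F.n q)) q :=
    hasFDerivAt_pi'.1 (differentiableAt_n hq).hasFDerivAt i
  have hxi (i : Fin 3) : HasFDerivAt (fun z => jac F.x z i j)
      ((ContinuousLinearMap.proj i).comp ((fderiv ℝ (fderiv ℝ F.x) q).flip (Pi.single j 1))) q := by
    have h1 := hd.hasFDerivAt.clm_apply (hasFDerivAt_const (Pi.single j 1 : Pt) q)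
    have h2 := hasFDerivAt_pi'.1 h1 i
    refine h2.congr_fderiv ?_
    ext v
    simp
  have hs := HasFDerivAt.fun_sum (u := Finset.univ) fun i _ => (hn i).mul (hxi i)
  have hz : (fun z => ∑ i, F.n z i * jac F.x z i j) =ᶠ[𝓝 q] fun _ => (0 : ℝ) := by
    filter_upwards [F.isOpen_U.mem_nhds hq] with z hzU
    exact normal_dotProduct_jac hzU j
  have h := congrArg (fun L => L (Pi.single k 1))
    (hs.unique ((hasFDerivAt_const 0 q).congr_of_eventuallyEq hz))
  simp only [Fin.sum_univ_three, jac, Matrix.of_apply] at h ⊢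
  simp at h
  linear_combination h

theorem second_form_symm (hq : q ∈ F.U) (j k : Fin 2) :
    ∑ i, jac F.x q i j * jac F.n q i k = ∑ i, jac F.x q i k * jac F.n q i j := by
  have hx : ContDiffAt ℝ (⊤ : ℕ∞) F.x q := F.smooth_x.contDiffAt (F.isOpen_U.mem_nhds hq)
  have hsymm : IsSymmSndFDerivAt ℝ F.x q := hx.isSymmSndFDerivAt (by
    rw [minSmoothness_of_isRCLikeNormedField]
    exact WithTop.coe_le_coe.2 (le_top : (2 : ℕ∞) ≤ ⊤))
  rw [jac_dotProduct_jac_normal hq, jac_dotProduct_jac_normal hq,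
    hsymm.eq (Pi.single k 1) (Pi.single j 1)]

theorem IOf_eq (hq : q ∈ F.U) :
    IOf F.x q = F.Λ q * ((F.Ω q)ᵀ * F.Ω q) * (F.Λ q)ᵀ := by
  simp only [IOf, F.decomp_x q hq, Matrix.transpose_mul, Matrix.transpose_transpose,
    Matrix.mul_assoc]

theorem IIOf_eq (hq : q ∈ F.U) :
    IIOf F.x F.n q = -(F.Λ q * ((F.Ω q)ᵀ * F.Ω q) * (F.μ q)ᵀ) := by
  have h : jac F.n q = F.Ω q * (F.μ q)ᵀ := F.decomp_n q hq
  simp only [IIOf, F.decomp_x q hq, h, Matrix.transpose_mul, Matrix.transpose_transpose,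
    Matrix.mul_assoc]

theorem det_IOf (hq : q ∈ F.U) :
    (IOf F.x q).det = F.lam q ^ 2 * ((F.Ω q)ᵀ * F.Ω q).det := by
  rw [IOf_eq hq, Matrix.det_mul, Matrix.det_mul, Matrix.det_transpose, lam]
  ring

theorem det_IIOf (hq : q ∈ F.U) :
    (IIOf F.x F.n q).det = F.lam q * F.KΩ q * ((F.Ω q)ᵀ * F.Ω q).det := by
  rw [IIOf_eq hq, Matrix.det_neg, Matrix.det_mul, Matrix.det_mul, Matrix.det_transpose, lam, KΩ]
  simp
  ring

theorem IIOf_symm (hq : q ∈ F.U) : IIOf F.x F.n q 1 0 = IIOf F.x F.n q 0 1 := by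
  have h := second_form_symm hq 1 0
  simp only [IIOf, Matrix.neg_apply, Matrix.mul_apply, Matrix.transpose_apply, h]

theorem trace_second_form_mul_adjugate (hq : q ∈ F.U) :
    ((IIOf F.x F.n q)ᵀ * (IOf F.x q).adjugate).trace =
      2 * F.lam q * ((F.Ω q)ᵀ * F.Ω q).det * F.HΩ q := by
  rw [IIOf_eq hq, IOf_eq hq, HΩ, αΩ, lam]
  have hs : ((F.Ω q)ᵀ * F.Ω q)ᵀ = (F.Ω q)ᵀ * F.Ω q := by simp
  generalize (F.Ω q)ᵀ * F.Ω q = G at hs ⊢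
  rw [Matrix.transpose_neg, Matrix.transpose_mul, Matrix.transpose_mul, Matrix.transpose_transpose,
    hs, Matrix.adjugate_mul_distrib, Matrix.adjugate_mul_distrib]
  have h : F.μ q * (G * (F.Λ q)ᵀ) * ((F.Λ q)ᵀ.adjugate * (G.adjugate * (F.Λ q).adjugate)) =
      ((F.Λ q).det * G.det) • (F.μ q * (F.Λ q).adjugate) := by
    calc _ = F.μ q * (G * ((F.Λ q)ᵀ * (F.Λ q)ᵀ.adjugate) * G.adjugate) * (F.Λ q).adjugate := by
          simp only [Matrix.mul_assoc]
      _ = _ := by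
          rw [Matrix.mul_adjugate, Matrix.det_transpose, Matrix.mul_smul, Matrix.mul_one,
            Matrix.smul_mul, Matrix.mul_adjugate]
          simp [smul_smul]
  rw [Matrix.neg_mul, h, Matrix.trace_neg, Matrix.trace_smul, smul_eq_mul]
  ring

theorem discrim_nonneg (hq : q ∈ F.reg) : 0 ≤ F.HΩ q ^ 2 - F.lam q * F.KΩ q := by
  obtain ⟨hU, hl⟩ := hq
  have hl : F.lam q ≠ 0 := hl
  have hg := gram_det_pos hU
  have hI := det_IOf hU
  have hII := det_IIOf hU
  have ht := trace_second_form_mul_adjugate hU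
  have hsI : IOf F.x q 1 0 = IOf F.x q 0 1 := by
    simp only [IOf, Matrix.mul_apply, Matrix.transpose_apply, mul_comm]
  have hE : 0 ≤ IOf F.x q 0 0 := by
    simp only [IOf, Matrix.mul_apply, Matrix.transpose_apply]
    exact Finset.sum_nonneg fun i _ => mul_self_nonneg _
  have hsII := IIOf_symm hU
  rw [Matrix.det_fin_two, hsI] at hI
  rw [Matrix.det_fin_two, hsII] at hII
  rw [Matrix.trace_fin_two, Matrix.adjugate_fin_two] at ht
  simp only [Matrix.mul_apply, Fin.sum_univ_two, Matrix.transpose_apply, Matrix.of_apply,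
    Matrix.cons_val', Matrix.cons_val_zero, Matrix.cons_val_one, Matrix.cons_val_fin_one,
    hsI, hsII] at ht
  have hd : 0 < IOf F.x q 0 0 * IOf F.x q 1 1 - IOf F.x q 0 1 ^ 2 := by
    rw [sq, hI]
    positivity
  have h := symm_pair_discrim_nonneg (e := IIOf F.x F.n q 0 0) (f := IIOf F.x F.n q 0 1)
    (g := IIOf F.x F.n q 1 1) hE hd
  have h1 : IIOf F.x F.n q 0 0 * IOf F.x q 1 1 - 2 * IIOf F.x F.n q 0 1 * IOf F.x q 0 1 +
      IIOf F.x F.n q 1 1 * IOf F.x q 0 0 =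
      2 * F.lam q * ((F.Ω q)ᵀ * F.Ω q).det * F.HΩ q := by
    linear_combination ht
  rw [h1, sq (IIOf F.x F.n q 0 1), sq (IOf F.x q 0 1), hI, hII] at h
  refine nonneg_of_mul_nonneg_right (a := 4 * (F.lam q * ((F.Ω q)ᵀ * F.Ω q).det) ^ 2) ?_
    (by positivity)
  linear_combination h

theorem Kg_eq (hq : q ∈ F.reg) : F.Kg q = F.KΩ q / F.lam q := by
  obtain ⟨hU, hl⟩ := hq
  have hl : F.lam q ≠ 0 := hl
  have hg := (gram_det_pos hU).ne'
  rw [Kg, KgOf, det_IOf hU, det_IIOf hU]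
  field_simp

theorem Hm_eq (hq : q ∈ F.reg) : F.Hm q = F.HΩ q / F.lam q := by
  obtain ⟨hU, hl⟩ := hq
  have hl : F.lam q ≠ 0 := hl
  have hg := (gram_det_pos hU).ne'
  rw [Hm, HmOf, weinOf, Matrix.inv_def, Matrix.mul_smul, Matrix.trace_neg, Matrix.trace_smul,
    trace_second_form_mul_adjugate hU, det_IOf hU, Ring.inverse_eq_inv', smul_eq_mul]
  field_simp

theorem principal_sqrt (hq : q ∈ F.reg) : √(F.Hm q ^ 2 - F.Kg q) =
    √(F.HΩ q ^ 2 - F.lam q * F.KΩ q) / |F.lam q| := by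
  have hl : F.lam q ≠ 0 := hq.2
  rw [Hm_eq hq, Kg_eq hq, ← Real.sqrt_sq_eq_abs, ← Real.sqrt_div (discrim_nonneg hq)]
  congr 1
  field_simp

theorem k1_eq (hq : q ∈ F.reg) : F.k1 q = F.k1Ω q / F.lam q := by
  have hl : F.lam q ≠ 0 := hq.2
  rw [k1, κm, κp, principal_sqrt hq, Hm_eq hq, k1Ω]
  split_ifs with h
  · rw [abs_of_pos h]
    ring
  · rw [abs_of_nonpos (not_lt.1 h), div_neg]
    ring

theorem k2_eq (hq : q ∈ F.reg) : F.k2 q = F.k2Ω q / F.lam q := by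
  have hl : F.lam q ≠ 0 := hq.2
  rw [k2, κm, κp, principal_sqrt hq, Hm_eq hq, k2Ω]
  split_ifs with h
  · rw [abs_of_pos h]
    ring
  · rw [abs_of_nonpos (not_lt.1 h), div_neg]
    ring

theorem k1Ω_mul_k2Ω (hq : q ∈ F.reg) : F.k1Ω q * F.k2Ω q = F.lam q * F.KΩ q := by
  rw [k1Ω, k2Ω]
  linear_combination -Real.sq_sqrt (discrim_nonneg hq)

theorem k1_inv (hq : q ∈ F.reg) (hK : F.KΩ q ≠ 0) :
    F.k1 q ≠ 0 ∧ (F.k1 q)⁻¹ = F.k2Ω q / F.KΩ q := by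
  have hl : F.lam q ≠ 0 := hq.2
  have h := k1Ω_mul_k2Ω hq
  have h1 : F.k1Ω q ≠ 0 := left_ne_zero_of_mul (h ▸ mul_ne_zero hl hK)
  rw [k1_eq hq]
  refine ⟨div_ne_zero h1 hl, ?_⟩
  rw [inv_div, div_eq_div_iff h1 hK, ← h, mul_comm]

theorem k2_inv (hq : q ∈ F.reg) (hK : F.KΩ q ≠ 0) :
    F.k2 q ≠ 0 ∧ (F.k2 q)⁻¹ = F.k1Ω q / F.KΩ q := by
  have hl : F.lam q ≠ 0 := hq.2
  have h := k1Ω_mul_k2Ω hq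
  have h2 : F.k2Ω q ≠ 0 := right_ne_zero_of_mul (h ▸ mul_ne_zero hl hK)
  rw [k2_eq hq]
  refine ⟨div_ne_zero h2 hl, ?_⟩
  rw [inv_div, div_eq_div_iff h2 hK, ← h]

variable (F)

theorem contDiffOn_lam : ContDiffOn ℝ (⊤ : ℕ∞) F.lam F.U := by
  refine ContDiffOn.congr (((F.smooth_Λ 0 0).mul (F.smooth_Λ 1 1)).sub
    ((F.smooth_Λ 0 1).mul (F.smooth_Λ 1 0))) fun q _ => ?_
  exact Matrix.det_fin_two _

theorem contDiffOn_KΩ : ContDiffOn ℝ (⊤ : ℕ∞) F.KΩ F.U := by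
  refine ContDiffOn.congr (((F.smooth_μ 0 0).mul (F.smooth_μ 1 1)).sub
    ((F.smooth_μ 0 1).mul (F.smooth_μ 1 0))) fun q _ => ?_
  exact Matrix.det_fin_two _

theorem HΩ_eq (q : Pt) : F.HΩ q = -(1 / 2) *
    ((F.μ q 0 0 * F.Λ q 1 1 - F.μ q 0 1 * F.Λ q 1 0) +
      (F.μ q 1 1 * F.Λ q 0 0 - F.μ q 1 0 * F.Λ q 0 1)) := by
  simp only [HΩ, αΩ, Matrix.trace_fin_two, Matrix.adjugate_fin_two, Matrix.mul_apply,
    Fin.sum_univ_two, Matrix.of_apply, Matrix.cons_val', Matrix.cons_val_zero,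
    Matrix.cons_val_one, Matrix.cons_val_fin_one]
  ring

theorem contDiffOn_HΩ : ContDiffOn ℝ (⊤ : ℕ∞) F.HΩ F.U := by
  refine ContDiffOn.congr (contDiffOn_const.mul
    ((((F.smooth_μ 0 0).mul (F.smooth_Λ 1 1)).sub ((F.smooth_μ 0 1).mul (F.smooth_Λ 1 0))).add
    (((F.smooth_μ 1 1).mul (F.smooth_Λ 0 0)).sub ((F.smooth_μ 1 0).mul (F.smooth_Λ 0 1)))))
    fun q _ => F.HΩ_eq q

theorem continuousOn_k1Ω : ContinuousOn F.k1Ω F.U :=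
  F.contDiffOn_HΩ.continuousOn.sub ((F.contDiffOn_HΩ.continuousOn.pow 2).sub
    (F.contDiffOn_lam.continuousOn.mul F.contDiffOn_KΩ.continuousOn)).sqrt

theorem continuousOn_k2Ω : ContinuousOn F.k2Ω F.U :=
  F.contDiffOn_HΩ.continuousOn.add ((F.contDiffOn_HΩ.continuousOn.pow 2).sub
    (F.contDiffOn_lam.continuousOn.mul F.contDiffOn_KΩ.continuousOn)).sqrt

variable {F}

theorem Λ_eq_zero_of_jac_eq_zero (hq : q ∈ F.U) (h : jac F.x q = 0) : F.Λ q = 0 := by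
  have h1 : ((F.Ω q)ᵀ * F.Ω q) * (F.Λ q)ᵀ = 0 := by
    rw [Matrix.mul_assoc, ← F.decomp_x q hq, h, Matrix.mul_zero]
  have hu : IsUnit ((F.Ω q)ᵀ * F.Ω q).det := (gram_det_pos hq).ne'.isUnit
  have h2 := congrArg (fun M => ((F.Ω q)ᵀ * F.Ω q)⁻¹ * M) h1
  simp only [Matrix.mul_zero] at h2
  rw [Matrix.nonsing_inv_mul_cancel_left _ _ hu] at h2
  exact Matrix.transpose_eq_zero.1 h2

theorem KΩ_ne_zero_of_jac_eq_zero (hW : F.IsWavefront) (hq : q ∈ F.U) (h : jac F.x q = 0) :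
    F.KΩ q ≠ 0 := by
  intro hK
  obtain ⟨v, hv, hv0⟩ := Matrix.exists_mulVec_eq_zero_iff.2
    ((Matrix.det_transpose (F.μ q)).trans hK)
  have hr := hW q hq
  have hn : jac F.n q = F.Ω q * (F.μ q)ᵀ := F.decomp_n q hq
  have hker : Matrix.fromRows (jac F.x q) (jac F.n q) *ᵥ v = 0 := by
    rw [Matrix.fromRows_mulVec, h, hn, ← Matrix.mulVec_mulVec, hv0]
    ext i
    rcases i with i | i <;> simp
  have hdim := (Matrix.fromRows (jac F.x q) (jac F.n q)).mulVecLin.finrank_range_add_finrank_ker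
  change Matrix.rank _ + _ = _ at hdim
  rw [hr] at hdim
  simp only [Module.finrank_fin_fun, Nat.add_eq_left, Submodule.finrank_eq_zero] at hdim
  exact hv ((Submodule.eq_bot_iff _).1 hdim v hker)

end Frontal

theorem tendsto_abs_atTop_of_inv {α : Type*} {l : Filter α} {f g : α → ℝ}
    (hfg : ∀ᶠ a in l, f a ≠ 0 ∧ (f a)⁻¹ = g a) (hg : Tendsto g l (𝓝 0)) :
    Tendsto (fun a => |f a|) l atTop := by
  have h : Tendsto (fun a => (f a)⁻¹) l (𝓝[≠] 0) := by
    refine tendsto_nhdsWithin_iff.2 ⟨hg.congr' (hfg.mono fun a ha => ha.2.symm), ?_⟩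
    exact hfg.mono fun a ha => inv_ne_zero ha.1
  have h' := (tendsto_norm_cobounded_atTop (E := ℝ)).comp (tendsto_inv₀_nhdsNE_zero.comp h)
  simpa [Function.comp_def] using h'

/-- at a rank-0 singularity of a proper wavefront:
`k_{1Ω}(p) = k_{2Ω}(p) = 0`; `|K| → ∞`; `1/k₁`, `1/k₂` admit continuous
extensions `k_{2Ω}/K_Ω`, `k_{1Ω}/K_Ω`; `|k₁| → ∞` and `|k₂| → ∞`; and
`1/k₁ + 1/k₂` admits the `C^∞` extension `2H_Ω/K_Ω`. -/
theorem stmt18 (F : Frontal) (hW : F.IsWavefront) (hP : F.IsProper)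
    (p : Pt) (hp : p ∈ F.sing) (hr : (jac F.x p).rank = 0) :
    (F.k1Ω p = 0 ∧ F.k2Ω p = 0) ∧
    Tendsto (fun q => |F.Kg q|) (nhdsWithin p F.reg) atTop ∧
    (∃ V : Set Pt, IsOpen V ∧ p ∈ V ∧ V ⊆ F.U ∧ (∀ q ∈ V, F.KΩ q ≠ 0) ∧
      ContinuousOn (fun q => F.k2Ω q / F.KΩ q) V ∧
      ContinuousOn (fun q => F.k1Ω q / F.KΩ q) V ∧
      ∀ q ∈ V ∩ F.reg,
        (F.k1 q)⁻¹ = F.k2Ω q / F.KΩ q ∧ (F.k2 q)⁻¹ = F.k1Ω q / F.KΩ q) ∧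
    (Tendsto (fun q => |F.k1 q|) (nhdsWithin p F.reg) atTop ∧
      Tendsto (fun q => |F.k2 q|) (nhdsWithin p F.reg) atTop) ∧
    (∃ V : Set Pt, IsOpen V ∧ p ∈ V ∧ V ⊆ F.U ∧ (∀ q ∈ V, F.KΩ q ≠ 0) ∧
      ContDiffOn ℝ (⊤ : ℕ∞) (fun q => 2 * F.HΩ q / F.KΩ q) V ∧
      ∀ q ∈ V ∩ F.reg,
        (F.k1 q)⁻¹ + (F.k2 q)⁻¹ = 2 * F.HΩ q / F.KΩ q) := by
  obtain ⟨hU, hl⟩ := hp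
  have hl : F.lam p = 0 := hl
  have hj : jac F.x p = 0 := by
    rw [Matrix.rank, Submodule.finrank_eq_zero, LinearMap.range_eq_bot] at hr
    exact Matrix.toLin'.injective (hr.trans (map_zero _).symm)
  have hΛ := Frontal.Λ_eq_zero_of_jac_eq_zero hU hj
  have hH : F.HΩ p = 0 := by
    simp [F.HΩ_eq, hΛ]
  have hK := Frontal.KΩ_ne_zero_of_jac_eq_zero hW hU hj
  have hk1 : F.k1Ω p = 0 := by
    simp [Frontal.k1Ω, hH, hl]
  have hk2 : F.k2Ω p = 0 := by
    simp [Frontal.k2Ω, hH, hl]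
  have hUn := F.isOpen_U.mem_nhds hU
  let V : Set Pt := F.U ∩ F.KΩ ⁻¹' {0}ᶜ
  have hVo : IsOpen V :=
    F.contDiffOn_KΩ.continuousOn.isOpen_inter_preimage F.isOpen_U isOpen_compl_singleton
  have hpV : p ∈ V := ⟨hU, hK⟩
  have hVU : V ⊆ F.U := Set.inter_subset_left
  have hVK : ∀ q ∈ V, F.KΩ q ≠ 0 := fun q hq => hq.2
  have hc1 : ContinuousOn (fun q => F.k1Ω q / F.KΩ q) V :=
    (F.continuousOn_k1Ω.mono hVU).div (F.contDiffOn_KΩ.continuousOn.mono hVU) hVK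
  have hc2 : ContinuousOn (fun q => F.k2Ω q / F.KΩ q) V :=
    (F.continuousOn_k2Ω.mono hVU).div (F.contDiffOn_KΩ.continuousOn.mono hVU) hVK
  have hcl : ContinuousOn (fun q => F.lam q / F.KΩ q) V :=
    (F.contDiffOn_lam.continuousOn.mono hVU).div (F.contDiffOn_KΩ.continuousOn.mono hVU) hVK
  have hlim {f : Pt → ℝ} (hf : ContinuousOn f V) (h0 : f p = 0) :
      Tendsto f (𝓝[F.reg] p) (𝓝 0) :=
    h0 ▸ (hf.continuousAt (hVo.mem_nhds hpV)).tendsto.mono_left nhdsWithin_le_nhds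
  have hev : ∀ᶠ q in 𝓝[F.reg] p, q ∈ F.reg ∧ F.KΩ q ≠ 0 := by
    filter_upwards [self_mem_nhdsWithin, mem_nhdsWithin_of_mem_nhds (hVo.mem_nhds hpV)]
      with q h1 h2 using ⟨h1, hVK q h2⟩
  refine ⟨⟨hk1, hk2⟩, ?_, ⟨V, hVo, hpV, hVU, hVK, hc2, hc1, fun q hq => ?_⟩, ⟨?_, ?_⟩,
    ⟨V, hVo, hpV, hVU, hVK, ?_, fun q hq => ?_⟩⟩
  · refine tendsto_abs_atTop_of_inv (hev.mono fun q hq => ?_) (hlim hcl (by simp [hl]))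
    rw [Frontal.Kg_eq hq.1, inv_div]
    exact ⟨div_ne_zero hq.2 hq.1.2, rfl⟩
  · exact ⟨(Frontal.k1_inv hq.2 (hVK q hq.1)).2, (Frontal.k2_inv hq.2 (hVK q hq.1)).2⟩
  · exact tendsto_abs_atTop_of_inv (hev.mono fun q hq => Frontal.k1_inv hq.1 hq.2)
      (hlim hc2 (by simp [hk2]))
  · exact tendsto_abs_atTop_of_inv (hev.mono fun q hq => Frontal.k2_inv hq.1 hq.2)
      (hlim hc1 (by simp [hk1]))
  · exact (contDiffOn_const.mul (F.contDiffOn_HΩ.mono hVU)).div (F.contDiffOn_KΩ.mono hVU) hVK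
  · rw [(Frontal.k1_inv hq.2 (hVK q hq.1)).2, (Frontal.k2_inv hq.2 (hVK q hq.1)).2, ← add_div,
      Frontal.k1Ω, Frontal.k2Ω]
    ring
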